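/- For every r > 0, every θ ∈ Θ, and every x ∈ X, the out-of-sample disappointment of the distributionally robust predictor satisfies limsup_{T→∞} (1/T)·log ℙ_θ( c(x,θ) > ĉ_r(x, θ̂_T) ) ≤ −r. -/

import Mathlib

open scoped Classical

noncomputable section

def Theta (d : ℕ) : Set (Matrix (Fin d) (Fin d) ℝ) :=
  {θ | (∀ i j, 0 < θ i j) ∧ (∑ i, ∑ j, θ i j) = 1 ∧ ∀ i, (∑ j, θ i j) = ∑ j, θ j i}

def ThetaP (d : ℕ) : Set (Matrix (Fin d) (Fin d) ℝ) :=
  {θ | (∀ i j, 0 ≤ θ i j) ∧ (∑ i, ∑ j, θ i j) = 1}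

/-- Conditional relative entropy, with the conventions `0·log(0/q) = 0` and `p·log(p/0) = ∞`. -/
def condRelEnt {d : ℕ} (θ' θ : Matrix (Fin d) (Fin d) ℝ) : EReal :=
  ∑ i, ∑ j,
    if θ' i j = 0 then (0 : EReal)
    else if θ i j = 0 then (⊤ : EReal)
    else ((θ' i j * (Real.log (θ' i j / ∑ k, θ' i k) - Real.log (θ i j / ∑ k, θ i k)) : ℝ) : EReal)

/-- Real-valued conditional relative entropy (valid whenever `θ` has positive entries,
so that no `∞` can occur; the convention `0·log(0/q) = 0` is automatic). -/
def condRelEntR {d : ℕ} (θ' θ : Matrix (Fin d) (Fin d) ℝ) : ℝ :=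
  ∑ i, ∑ j, θ' i j * (Real.log (θ' i j / ∑ k, θ' i k) - Real.log (θ i j / ∑ k, θ i k))

/-- Empirical doublet distribution of the trajectory `ξ_0, …, ξ_T`. -/
def empDoublet {d : ℕ} (T : ℕ) (ξ : ℕ → Fin d) : Matrix (Fin d) (Fin d) ℝ :=
  Matrix.of fun i j =>
    (1 / (T : ℝ)) * ∑ t ∈ Finset.range T, if ξ t = i ∧ ξ (t + 1) = j then (1 : ℝ) else 0

/-- Transition matrix associated with a doublet distribution. -/
def transOf {d : ℕ} (θ : Matrix (Fin d) (Fin d) ℝ) : Matrix (Fin d) (Fin d) ℝ :=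
  Matrix.of fun i j => θ i j / ∑ k, θ i k

/-- The trajectory `ξ_0 = ξ0, ξ_1 = w_0, …, ξ_T = w_{T-1}` (junk value `ξ0` beyond `T`). -/
def seqOf {d : ℕ} (ξ0 : Fin d) {T : ℕ} (w : Fin T → Fin d) : ℕ → Fin d :=
  fun t => if h : 1 ≤ t ∧ t ≤ T then w ⟨t - 1, by omega⟩ else ξ0

/-- Probability of the trajectory `ξ0, w_0, …, w_{T-1}` under the Markov chain with
transition matrix `P` started at `ξ0`. -/
def pathProb {d : ℕ} (P : Matrix (Fin d) (Fin d) ℝ) (ξ0 : Fin d) (T : ℕ)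
    (w : Fin T → Fin d) : ℝ :=
  ∏ t ∈ Finset.range T, P (seqOf ξ0 w t) (seqOf ξ0 w (t + 1))

/-- `ℙ_θ(E(θ̂_T))`: probability, under the Markov chain with transition matrix `P` started
at `ξ0`, that the empirical doublet distribution after `T` steps satisfies `E`. -/
def probEmp {d : ℕ} (P : Matrix (Fin d) (Fin d) ℝ) (ξ0 : Fin d) (T : ℕ)
    (E : Matrix (Fin d) (Fin d) ℝ → Prop) : ℝ :=
  ∑ w : Fin T → Fin d, if E (empDoublet T (seqOf ξ0 w)) then pathProb P ξ0 T w else 0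

/-- Logarithm with values in `EReal`, sending `0` (and negative reals) to `−∞`. -/
def elog (x : ℝ) : EReal := if x ≤ 0 then (⊥ : EReal) else ((Real.log x : ℝ) : EReal)

/-- Expected loss `c(x,θ)` for a fixed loss vector `ℓ = L(x,·)`. -/
def cfun {d : ℕ} (ℓ : Fin d → ℝ) (θ : Matrix (Fin d) (Fin d) ℝ) : ℝ :=
  ∑ i, ∑ j, ℓ i * θ i j

/-- The distributionally robust predictor `ĉ_r(x,θ')` (for the loss vector `ℓ = L(x,·)`):
the maximum of `c(x,·)` over the conditional-relative-entropy ball when it is nonempty,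
and the maximum over all of `cl Θ` otherwise. -/
def chat {d : ℕ} (ℓ : Fin d → ℝ) (r : ℝ) (θ' : Matrix (Fin d) (Fin d) ℝ) : ℝ :=
  if {θ | θ ∈ closure (Theta d) ∧ condRelEnt θ' θ ≤ (r : EReal)}.Nonempty then
    sSup (cfun ℓ '' {θ | θ ∈ closure (Theta d) ∧ condRelEnt θ' θ ≤ (r : EReal)})
  else sSup (cfun ℓ '' closure (Theta d))

lemma EReal.coe_finset_sum_real {ι : Type*} (s : Finset ι) (f : ι → ℝ) :
    ((∑ i ∈ s, f i : ℝ) : EReal) = ∑ i ∈ s, (f i : EReal) :=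
  map_sum (⟨⟨Real.toEReal, EReal.coe_zero⟩, EReal.coe_add⟩ : ℝ →+ EReal) f s

/-- Against a reference doublet distribution with nonzero entries, the extended-real conditional
relative entropy is finite. -/
lemma condRelEnt_eq_coe {d : ℕ} (θ' θ : Matrix (Fin d) (Fin d) ℝ) (hθ : ∀ i j, θ i j ≠ 0) :
    condRelEnt θ' θ = (condRelEntR θ' θ : EReal) := by
  unfold condRelEnt condRelEntR
  rw [EReal.coe_finset_sum_real]
  refine Finset.sum_congr rfl fun i _ => ?_
  rw [EReal.coe_finset_sum_real]
  refine Finset.sum_congr rfl fun j _ => ?_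
  by_cases h : θ' i j = 0 <;> simp [h, hθ i j]

lemma cfun_le_of_mem_closure_Theta {d : ℕ} (ℓ : Fin d → ℝ) {θ : Matrix (Fin d) (Fin d) ℝ}
    (hθ : θ ∈ closure (Theta d)) : cfun ℓ θ ≤ ∑ i, ∑ _j : Fin d, |ℓ i| := by
  have hc : Continuous (cfun ℓ) := by unfold cfun; fun_prop
  suffices hsub : Theta d ⊆ {m | cfun ℓ m ≤ ∑ i, ∑ _j : Fin d, |ℓ i|} from
    closure_minimal hsub (isClosed_le hc continuous_const) hθ
  rintro m ⟨hpos, hsum, -⟩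
  rw [Set.mem_setOf_eq, cfun]
  refine Finset.sum_le_sum fun i _ => Finset.sum_le_sum fun j _ => ?_
  have h1 : m i j ≤ 1 := by
    rw [← hsum]
    calc m i j ≤ ∑ j, m i j :=
          Finset.single_le_sum (f := fun j => m i j) (fun j _ => (hpos i j).le) (Finset.mem_univ j)
      _ ≤ ∑ i, ∑ j, m i j :=
          Finset.single_le_sum (f := fun i => ∑ j, m i j)
            (fun i _ => Finset.sum_nonneg fun j _ => (hpos i j).le) (Finset.mem_univ i)
  calc ℓ i * m i j ≤ |ℓ i| * m i j := mul_le_mul_of_nonneg_right (le_abs_self _) (hpos i j).le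
    _ ≤ |ℓ i| := mul_le_of_le_one_right (abs_nonneg _) h1

/-- A disappointing estimator realization lies outside the conditional-relative-entropy ball. -/
lemma lt_condRelEntR_of_chat_lt {d : ℕ} {ℓ : Fin d → ℝ} {r : ℝ}
    {θ m : Matrix (Fin d) (Fin d) ℝ} (hθ : θ ∈ Theta d) (h : chat ℓ r m < cfun ℓ θ) :
    r < condRelEntR m θ := by
  by_contra! hle
  have hmem : θ ∈ {θ | θ ∈ closure (Theta d) ∧ condRelEnt m θ ≤ (r : EReal)} := by
    refine ⟨subset_closure hθ, ?_⟩
    rw [condRelEnt_eq_coe m θ fun i j => (hθ.1 i j).ne']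
    exact_mod_cast hle
  rw [chat, if_pos ⟨θ, hmem⟩] at h
  refine h.not_ge (le_csSup ⟨∑ i, ∑ _j : Fin d, |ℓ i|, ?_⟩ (Set.mem_image_of_mem _ hmem))
  rintro _ ⟨m', hm', rfl⟩
  exact cfun_le_of_mem_closure_Theta ℓ hm'.1

lemma seqOf_zero {d : ℕ} (ξ0 : Fin d) {T : ℕ} (w : Fin T → Fin d) : seqOf ξ0 w 0 = ξ0 := by
  simp [seqOf]

lemma seqOf_cons_succ {d : ℕ} (ξ0 a : Fin d) {T : ℕ} (w : Fin T → Fin d) {t : ℕ} (ht : t ≤ T) :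
    seqOf ξ0 (Fin.cons a w : Fin (T + 1) → Fin d) (t + 1) = seqOf a w t := by
  cases t with
  | zero => simp [seqOf]
  | succ s =>
    have h1 : 1 ≤ s + 1 + 1 ∧ s + 1 + 1 ≤ T + 1 := by omega
    have h2 : 1 ≤ s + 1 ∧ s + 1 ≤ T := by omega
    simp only [seqOf, dif_pos h1, dif_pos h2]
    exact Fin.cons_succ (α := fun _ => Fin d) a w ⟨s, by omega⟩

lemma pathProb_cons {d : ℕ} (P : Matrix (Fin d) (Fin d) ℝ) (ξ0 a : Fin d) {T : ℕ}
    (w : Fin T → Fin d) :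
    pathProb P ξ0 (T + 1) (Fin.cons a w : Fin (T + 1) → Fin d) = P ξ0 a * pathProb P a T w := by
  rw [pathProb, Finset.prod_range_succ', mul_comm, seqOf_zero, seqOf_cons_succ ξ0 a w T.zero_le,
    seqOf_zero, pathProb]
  congr 1
  refine Finset.prod_congr rfl fun t ht => ?_
  have := Finset.mem_range.1 ht
  rw [seqOf_cons_succ ξ0 a w (by omega), seqOf_cons_succ ξ0 a w (by omega)]

lemma pathProb_nonneg {d : ℕ} {P : Matrix (Fin d) (Fin d) ℝ} (hP : ∀ i j, 0 ≤ P i j)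
    (ξ0 : Fin d) {T : ℕ} (w : Fin T → Fin d) : 0 ≤ pathProb P ξ0 T w :=
  Finset.prod_nonneg fun _ _ => hP _ _

lemma sum_pathProb_le_one {d : ℕ} {P : Matrix (Fin d) (Fin d) ℝ} (hP : ∀ i j, 0 ≤ P i j)
    (hrow : ∀ i, ∑ j, P i j ≤ 1) (T : ℕ) (ξ0 : Fin d) :
    ∑ w : Fin T → Fin d, pathProb P ξ0 T w ≤ 1 := by
  induction T generalizing ξ0 with
  | zero => simp [pathProb]
  | succ T ih =>
    rw [← (Fin.consEquiv fun _ : Fin (T + 1) => Fin d).sum_comp, Fintype.sum_prod_type]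
    calc ∑ a, ∑ w : Fin T → Fin d, pathProb P ξ0 (T + 1) (Fin.cons a w : Fin (T + 1) → Fin d)
        = ∑ a, P ξ0 a * ∑ w : Fin T → Fin d, pathProb P a T w := by
          simp only [pathProb_cons, Finset.mul_sum]
      _ ≤ ∑ a, P ξ0 a :=
          Finset.sum_le_sum fun a _ => mul_le_of_le_one_right (hP _ _) (ih a)
      _ ≤ 1 := hrow ξ0

lemma empDoublet_nonneg {d : ℕ} (T : ℕ) (ξ : ℕ → Fin d) (i j : Fin d) :
    0 ≤ empDoublet T ξ i j := by
  simp only [empDoublet, Matrix.of_apply]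
  exact mul_nonneg (by positivity) (Finset.sum_nonneg fun t _ => by split_ifs <;> norm_num)

lemma empDoublet_pos {d T : ℕ} (ξ : ℕ → Fin d) {t : ℕ} (ht : t < T) :
    0 < empDoublet T ξ (ξ t) (ξ (t + 1)) := by
  have hT : (0 : ℝ) < T := by exact_mod_cast (Nat.zero_le t).trans_lt ht
  simp only [empDoublet, Matrix.of_apply]
  refine mul_pos (by positivity) (Finset.sum_pos' (fun s _ => by split_ifs <;> norm_num)
    ⟨t, Finset.mem_range.2 ht, by simp⟩)

lemma sum_range_eq_empDoublet {d T : ℕ} (hT : T ≠ 0) (ξ : ℕ → Fin d) (f : Fin d → Fin d → ℝ) :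
    ∑ t ∈ Finset.range T, f (ξ t) (ξ (t + 1)) = T * ∑ i, ∑ j, empDoublet T ξ i j * f i j := by
  have hT' : (T : ℝ) ≠ 0 := by exact_mod_cast hT
  have hf : ∀ t, f (ξ t) (ξ (t + 1)) =
      ∑ i, ∑ j, (if ξ t = i ∧ ξ (t + 1) = j then (1 : ℝ) else 0) * f i j := by
    intro t
    simp [ite_and]
  simp only [hf, empDoublet, Matrix.of_apply, Finset.mul_sum]
  rw [Finset.sum_comm]
  refine Finset.sum_congr rfl fun i _ => ?_
  rw [Finset.sum_comm]
  refine Finset.sum_congr rfl fun j _ => ?_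
  rw [Finset.sum_mul, Finset.mul_sum]
  refine Finset.sum_congr rfl fun t _ => ?_
  field_simp

lemma pathProb_eq_exp {d T : ℕ} (hT : T ≠ 0) (P : Matrix (Fin d) (Fin d) ℝ) (ξ0 : Fin d)
    (w : Fin T → Fin d) (hP : ∀ t < T, 0 < P (seqOf ξ0 w t) (seqOf ξ0 w (t + 1))) :
    pathProb P ξ0 T w =
      Real.exp (T * ∑ i, ∑ j, empDoublet T (seqOf ξ0 w) i j * Real.log (P i j)) := by
  rw [← sum_range_eq_empDoublet hT (seqOf ξ0 w) fun i j => Real.log (P i j), Real.exp_sum, pathProb]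
  exact Finset.prod_congr rfl fun t ht => (Real.exp_log (hP t (Finset.mem_range.1 ht))).symm

lemma transOf_nonneg {d : ℕ} {m : Matrix (Fin d) (Fin d) ℝ} (hm : ∀ i j, 0 ≤ m i j)
    (i j : Fin d) : 0 ≤ transOf m i j :=
  div_nonneg (hm i j) (Finset.sum_nonneg fun k _ => hm i k)

lemma transOf_pos {d : ℕ} {m : Matrix (Fin d) (Fin d) ℝ} (hm : ∀ i j, 0 ≤ m i j)
    {i j : Fin d} (hij : 0 < m i j) : 0 < transOf m i j :=
  div_pos hij (Finset.sum_pos' (fun k _ => hm i k) ⟨j, Finset.mem_univ j, hij⟩)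

lemma sum_transOf_le_one {d : ℕ} (m : Matrix (Fin d) (Fin d) ℝ) (i : Fin d) :
    ∑ j, transOf m i j ≤ 1 := by
  simp only [transOf, Matrix.of_apply, ← Finset.sum_div]
  exact div_self_le_one _

/-- Change of measure from the chain of `θ` to the chain of the empirical doublet distribution. -/
lemma pathProb_transOf_eq {d T : ℕ} (hT : T ≠ 0) {θ : Matrix (Fin d) (Fin d) ℝ}
    (hθ : ∀ i j, 0 < θ i j) (ξ0 : Fin d) (w : Fin T → Fin d) :
    pathProb (transOf θ) ξ0 T w =
      Real.exp (-(T * condRelEntR (empDoublet T (seqOf ξ0 w)) θ)) *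
        pathProb (transOf (empDoublet T (seqOf ξ0 w))) ξ0 T w := by
  rw [pathProb_eq_exp hT (transOf θ) ξ0 w fun t _ =>
      transOf_pos (fun i j => (hθ i j).le) (hθ _ _),
    pathProb_eq_exp hT (transOf (empDoublet T (seqOf ξ0 w))) ξ0 w fun t ht =>
      transOf_pos (empDoublet_nonneg T _) (empDoublet_pos _ ht),
    ← Real.exp_add]
  congr 1
  simp only [condRelEntR, transOf, Matrix.of_apply, mul_sub, Finset.sum_sub_distrib]
  ring

/-- There are at most `(T + 1) ^ (d * d)` empirical doublet distributions. -/
lemma card_image_empDoublet_le (d T : ℕ) (ξ0 : Fin d) :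
    (Finset.univ.image fun w : Fin T → Fin d => empDoublet T (seqOf ξ0 w)).card ≤
      (T + 1) ^ (d * d) := by
  let ofCounts : (Fin d → Fin d → Fin (T + 1)) → Matrix (Fin d) (Fin d) ℝ :=
    fun N => Matrix.of fun i j => (1 / (T : ℝ)) * (N i j : ℕ)
  have hsub : (Finset.univ.image fun w : Fin T → Fin d => empDoublet T (seqOf ξ0 w)) ⊆
      Finset.univ.image ofCounts := by
    intro m hm
    obtain ⟨w, -, rfl⟩ := Finset.mem_image.1 hm
    refine Finset.mem_image.2 ⟨fun i j => ⟨((Finset.range T).filter fun t =>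
      seqOf ξ0 w t = i ∧ seqOf ξ0 w (t + 1) = j).card, ?_⟩, Finset.mem_univ _, ?_⟩
    · exact Nat.lt_succ_of_le ((Finset.card_filter_le _ _).trans_eq (Finset.card_range T))
    · ext i j
      simp [ofCounts, empDoublet]
  refine (Finset.card_le_card hsub).trans (Finset.card_image_le.trans_eq ?_)
  simp [pow_mul]

/-- Finite-time bound: the probability of an event that keeps the empirical doublet distribution
at conditional relative entropy at least `r` decays like `exp (-r T)` up to a polynomial factor. -/
lemma probEmp_le {d T : ℕ} (hT : T ≠ 0) {θ : Matrix (Fin d) (Fin d) ℝ}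
    (hθ : ∀ i j, 0 < θ i j) (ξ0 : Fin d) {r : ℝ} {E : Matrix (Fin d) (Fin d) ℝ → Prop}
    (hE : ∀ m, E m → r ≤ condRelEntR m θ) :
    probEmp (transOf θ) ξ0 T E ≤ ((T : ℝ) + 1) ^ (d * d) * Real.exp (-(T * r)) := by
  set S := Finset.univ.image fun w : Fin T → Fin d => empDoublet T (seqOf ξ0 w) with hS
  rw [probEmp, ← Finset.sum_fiberwise_of_maps_to (t := S)
    fun w hw => Finset.mem_image_of_mem (fun w => empDoublet T (seqOf ξ0 w)) hw]
  have key : ∀ m ∈ S, (∑ w : Fin T → Fin d with empDoublet T (seqOf ξ0 w) = m,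
      if E (empDoublet T (seqOf ξ0 w)) then pathProb (transOf θ) ξ0 T w else 0) ≤
      Real.exp (-(T * r)) := by
    intro m hm
    have hm0 : ∀ i j, 0 ≤ m i j := by
      obtain ⟨w, -, rfl⟩ := Finset.mem_image.1 hm
      exact empDoublet_nonneg T _
    calc (∑ w : Fin T → Fin d with empDoublet T (seqOf ξ0 w) = m,
          if E (empDoublet T (seqOf ξ0 w)) then pathProb (transOf θ) ξ0 T w else 0)
        ≤ ∑ w : Fin T → Fin d with empDoublet T (seqOf ξ0 w) = m,
          Real.exp (-(T * r)) * pathProb (transOf m) ξ0 T w := by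
          refine Finset.sum_le_sum fun w hw => ?_
          have hwm := (Finset.mem_filter.1 hw).2
          have hQ := pathProb_nonneg (transOf_nonneg hm0) ξ0 w
          split_ifs with h
          · rw [pathProb_transOf_eq hT hθ, hwm]
            have := hE _ h
            rw [hwm] at this
            gcongr
          · positivity
      _ ≤ ∑ w : Fin T → Fin d, Real.exp (-(T * r)) * pathProb (transOf m) ξ0 T w :=
          Finset.sum_le_sum_of_subset_of_nonneg (Finset.filter_subset _ _) fun w _ _ =>
            mul_nonneg (Real.exp_pos _).le (pathProb_nonneg (transOf_nonneg hm0) ξ0 w)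
      _ ≤ Real.exp (-(T * r)) := by
          rw [← Finset.mul_sum]
          exact mul_le_of_le_one_right (Real.exp_pos _).le
            (sum_pathProb_le_one (transOf_nonneg hm0) (sum_transOf_le_one m) T ξ0)
  refine (Finset.sum_le_card_nsmul S _ _ key).trans ?_
  rw [nsmul_eq_mul]
  gcongr
  exact_mod_cast card_image_empDoublet_le d T ξ0

lemma inv_mul_elog_le {T K : ℕ} (hT : T ≠ 0) {p r : ℝ}
    (hp : p ≤ ((T : ℝ) + 1) ^ K * Real.exp (-(T * r))) :
    (((T : ℝ)⁻¹ : ℝ) : EReal) * elog p ≤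
      ((K * (Real.log 2 / T + Real.log T / T) - r : ℝ) : EReal) := by
  have hT0 : (0 : ℝ) < T := by exact_mod_cast Nat.pos_of_ne_zero hT
  have hT1 : (1 : ℝ) ≤ T := by exact_mod_cast Nat.one_le_iff_ne_zero.2 hT
  unfold elog
  split_ifs with h0
  · rw [EReal.coe_mul_bot_of_pos (inv_pos.2 hT0)]
    exact bot_le
  · rw [← EReal.coe_mul, EReal.coe_le_coe_iff]
    have hlog : Real.log p ≤ K * (Real.log 2 + Real.log T) - T * r := by
      calc Real.log p ≤ Real.log ((2 * (T : ℝ)) ^ K * Real.exp (-(T * r))) := by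
            refine Real.log_le_log (not_le.1 h0) (hp.trans ?_)
            gcongr
            linarith
        _ = _ := by
            rw [Real.log_mul (by positivity) (Real.exp_pos _).ne', Real.log_exp, Real.log_pow,
              Real.log_mul two_ne_zero hT0.ne']
            ring
    calc (T : ℝ)⁻¹ * Real.log p ≤ (T : ℝ)⁻¹ * (K * (Real.log 2 + Real.log T) - T * r) := by
          gcongr
      _ = _ := by field_simp

lemma tendsto_log_div_natCast_error (K r : ℝ) :
    Filter.Tendsto (fun T : ℕ => K * (Real.log 2 / T + Real.log T / T) - r) Filter.atTop
      (nhds (-r)) := by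
  have hlog : Filter.Tendsto (fun T : ℕ => Real.log T / T) Filter.atTop (nhds 0) :=
    Real.isLittleO_log_id_atTop.tendsto_div_nhds_zero.comp tendsto_natCast_atTop_atTop
  have hlog2 := tendsto_const_div_atTop_nhds_zero_nat (Real.log 2)
  simpa using ((hlog2.add hlog).const_mul K).sub_const r

theorem stmt_15 (d n : ℕ) (hd : 1 ≤ d) (X : Set (Fin n → ℝ)) (hX : IsCompact X)
    (L : (Fin n → ℝ) → Fin d → ℝ) (hL : ∀ i, ContinuousOn (fun x => L x i) X)
    (r : ℝ) (hr : 0 < r) (θ : Matrix (Fin d) (Fin d) ℝ) (hθ : θ ∈ Theta d)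
    (ξ0 : Fin d) (x : Fin n → ℝ) (hx : x ∈ X) :
    Filter.limsup
        (fun T : ℕ => (((T : ℝ)⁻¹ : ℝ) : EReal) *
          elog (probEmp (transOf θ) ξ0 T (fun m => chat (L x) r m < cfun (L x) θ)))
        Filter.atTop ≤ -(r : EReal) := by
  have hlim := (continuous_coe_real_ereal.tendsto (-r)).comp
    (tendsto_log_div_natCast_error ((d * d : ℕ) : ℝ) r)
  rw [← EReal.coe_neg, ← hlim.limsup_eq]
  refine Filter.limsup_le_limsup ?_
  filter_upwards [Filter.eventually_ne_atTop 0] with T hT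
  exact inv_mul_elog_le hT
    (probEmp_le hT hθ.1 ξ0 fun m hm => (lt_condRelEntR_of_chat_lt hθ hm).le)
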